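/- arXiv:1805.04085 — 4 statements merged into one kernel-verified Lean document; each statement's English description precedes it below -/
import Mathlib

section
/- Let c ≥ 1, let G be a group, and let H be a subgroup of G that is nilpotent of class at most c, is generated by a finite set E, and is maximal among all subgroups of G that are nilpotent of class at most c (that is, if H ≤ K ≤ G and K is nilpotent of class at most c, then K = H). Then for every x ∈ G: x ∈ H if and only if every left-normed commutator [z₁, …, z_{c+1}] of length c+1 with all entries z₁, …, z_{c+1} ∈ E ∪ {x} equals 1. -/
/-- The left-normed commutator of a list of group elements, with the convention
`[x,y] = x⁻¹y⁻¹xy` and `[x₁, …, x_{k+1}] = [[x₁, …, x_k], x_{k+1}]`.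
The left-normed commutator of the singleton list `[x]` is `x` itself. -/
def leftNormedComm {G : Type*} [Group G] : List G → G
  | [] => 1
  | x :: xs => xs.foldl (fun a b => a⁻¹ * b⁻¹ * a * b) x

theorem foldl_mem_lcs {G : Type*} [Group G] (H : Subgroup G) :
    ∀ (l : List G) (k : ℕ) (a : G), (∀ z ∈ l, z ∈ H) → a ∈ H.lowerCentralSeries k →
      l.foldl (fun a b => a⁻¹ * b⁻¹ * a * b) a ∈ H.lowerCentralSeries (k + l.length)
  | [], k, a, _, ha => by simpa using ha
  | b :: l, k, a, hl, ha => by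
    have h1 : a⁻¹ * b⁻¹ * a * b ∈ H.lowerCentralSeries (k + 1) := by
      have h := Subgroup.commutator_mem_commutator (inv_mem ha)
        (inv_mem (hl b (by simp)))
      simpa [commutatorElement_def] using h
    have h2 := foldl_mem_lcs H l (k + 1) _ (fun z hz => hl z (by simp [hz])) h1
    rw [List.foldl_cons, List.length_cons, show k + (l.length + 1) = k + 1 + l.length by omega]
    exact h2

open commutatorElement in
theorem mem_ucs_step {K : Type*} [Group K] (X : Set K) (hX : Subgroup.closure X = ⊤)
    (N : Subgroup K) [N.Normal] (g : K) (h : ∀ x ∈ X, g⁻¹ * x⁻¹ * g * x ∈ N) (y : K) :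
    ⁅g, y⁆ ∈ N := by
  have key : Commute (g : K ⧸ N) (y : K ⧸ N) := by
    have hy : y ∈ Subgroup.closure X := by rw [hX]; trivial
    induction hy using Subgroup.closure_induction with
    | mem x hx =>
      have : ((x * g : K) : K ⧸ N) = ((g * x : K) : K ⧸ N) := by
        rw [QuotientGroup.eq]
        simpa [mul_assoc] using h x hx
      exact this.symm
    | one => exact Commute.one_right _
    | mul a b _ _ ha hb => exact Commute.mul_right ha hb
    | inv a _ ha => exact Commute.inv_right ha
  rw [← QuotientGroup.eq_one_iff]
  exact commutatorElement_eq_one_iff_commute.mpr key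

theorem lnc_mem_ucs {K : Type*} [Group K] (X : Set K) (hX : Subgroup.closure X = ⊤) (c : ℕ)
    (h : ∀ l : List K, l.length = c + 1 → (∀ z ∈ l, z ∈ X) → leftNormedComm l = 1) :
    ∀ j ≤ c, ∀ l : List K, l.length + j = c + 1 → (∀ z ∈ l, z ∈ X) →
      leftNormedComm l ∈ Subgroup.upperCentralSeries K j := by
  intro j
  induction j with
  | zero =>
    intro _ l hl hz
    rw [h l (by omega) hz]
    exact one_mem _
  | succ j ih =>
    intro hj l hl hz
    rw [Subgroup.mem_upperCentralSeries_succ_iff]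
    apply mem_ucs_step X hX
    intro x hx
    have := ih (by omega) (l ++ [x]) (by simp; omega) (by
      intro z hz'
      rcases List.mem_append.mp hz' with h' | h'
      · exact hz z h'
      · rw [List.mem_singleton.mp h']; exact hx)
    cases l with
    | nil => simp at hl; omega
    | cons a l => simpa [leftNormedComm] using this

theorem lcs_bot_of_lnc {K : Type*} [Group K] (X : Set K) (hX : Subgroup.closure X = ⊤) (c : ℕ)
    (h : ∀ l : List K, l.length = c + 1 → (∀ z ∈ l, z ∈ X) → leftNormedComm l = 1) :
    Subgroup.lowerCentralSeries (⊤ : Subgroup K) c = ⊥ := by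
  rw [Subgroup.lowerCentralSeries_eq_bot_iff_upperCentralSeries_eq_top, eq_top_iff, ← hX,
    Subgroup.closure_le]
  intro x hx
  exact lnc_mem_ucs X hX c h c le_rfl [x] (by simp; omega) (by simpa using hx)

theorem map_lnc {K G : Type*} [Group K] [Group G] (f : K →* G) (l : List K) :
    f (leftNormedComm l) = leftNormedComm (l.map f) := by
  cases l with
  | nil => simp [leftNormedComm]
  | cons a l =>
    simp only [leftNormedComm, List.map_cons]
    induction l generalizing a with
    | nil => rfl
    | cons b l ih => simp only [List.foldl_cons, List.map_cons, ih, map_mul, map_inv]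

/-- Let `c ≥ 1` and let `H ≤ G` be a subgroup which is nilpotent of class at most `c`
(i.e. `lowerCentralSeries H c = ⊥`), generated by a finite set `E`, and maximal among
subgroups of `G` that are nilpotent of class at most `c`. Then `x ∈ H` if and only if
every left-normed commutator of length `c+1` with entries in `E ∪ {x}` is trivial. -/
theorem stmt_4 {G : Type*} [Group G] (c : ℕ) (hc : 1 ≤ c)
    (H : Subgroup G) (E : Finset G) (hE : Subgroup.closure (E : Set G) = H)
    (hnil : lowerCentralSeries H c = ⊥)
    (hmax : ∀ K : Subgroup G, H ≤ K → lowerCentralSeries K c = ⊥ → K = H) :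
    ∀ x : G, x ∈ H ↔
      ∀ l : List G, l.length = c + 1 → (∀ z ∈ l, z ∈ (E : Set G) ∪ {x}) →
        leftNormedComm l = 1 := by
  have hnil' : H.lowerCentralSeries c = ⊥ := hnil
  intro x
  constructor
  · intro hx l hl hz
    have hH : ∀ z ∈ l, z ∈ H := by
      intro z hzl
      rcases hz z hzl with h | h
      · rw [← hE]; exact Subgroup.subset_closure h
      · rw [Set.mem_singleton_iff.mp h]; exact hx
    cases l with
    | nil => rfl
    | cons a l =>
      have h := foldl_mem_lcs H l 0 a (fun z hz => hH z (by simp [hz])) (hH a (by simp))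
      have hl' : 0 + l.length = c := by simp at hl; omega
      rw [hl', hnil'] at h
      exact Subgroup.mem_bot.mp h
  · intro h
    let K : Subgroup G := Subgroup.closure ((E : Set G) ∪ {x})
    have hxK : x ∈ K := Subgroup.subset_closure (Or.inr rfl)
    have hHK : H ≤ K := by
      rw [← hE]; exact Subgroup.closure_mono Set.subset_union_left
    have hK : K.lowerCentralSeries c = ⊥ := by
      have := lcs_bot_of_lnc (K := K) (((↑) : K → G) ⁻¹' ((E : Set G) ∪ {x}))
        (Subgroup.closure_closure_coe_preimage) c (by
          intro l hl hz
          apply K.subtype_injective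
          rw [map_lnc, map_one]
          apply h _ (by simpa using hl)
          intro z hz'
          obtain ⟨w, hw, rfl⟩ := List.mem_map.mp hz'
          exact hz w hw)
      rw [← Subgroup.top_subtype_lowerCentralSeries, this, Subgroup.map_bot]
    rw [← hmax K hHK hK]
    exact hxK
end

section
/- Let A be a nontrivial finitely generated abelian group whose rank is at most 2, and let R be a commutative subring (containing the identity endomorphism) of the endomorphism ring End(A) of A. Then the rank of the additive group of R is at most 2. -/
theorem aux_F {F : Type*} [AddCommGroup F]
    (tf : ∀ (n : ℤ) (a : F), n • a = 0 → n = 0 ∨ a = 0)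
    (hrk : ∀ p q r : F, ∃ a b c : ℤ, a • p + b • q + c • r = 0 ∧ ¬ (a = 0 ∧ b = 0 ∧ c = 0))
    (S : Set (Module.End ℤ F)) (hc : ∀ f ∈ S, ∀ g ∈ S, ∀ x, f (g x) = g (f x))
    (E : ∀ e : F, ∃ f ∈ S, f ≠ 0 ∧ f e = 0) : False := by
  have K : ∀ e u : F, (∀ a b : ℤ, a • e + b • u = 0 → a = 0 ∧ b = 0) →
      ∀ f : Module.End ℤ F, f e = 0 → f u = 0 → f = 0 := by
    intro e u hi f he hu
    ext w
    obtain ⟨a, b, c, h, hn⟩ := hrk e u w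
    have h1 : c • f w = 0 := by
      have := congrArg f h
      simpa [he, hu] using this
    rcases tf _ _ h1 with h2 | h2
    · subst h2
      simp only [zero_smul, add_zero] at h
      exact absurd ⟨(hi a b h).1, (hi a b h).2, rfl⟩ hn
    · simpa using h2
  have nz : ∀ f : Module.End ℤ F, f ≠ 0 → ∃ x, f x ≠ 0 := by
    intro f hf
    by_contra! h
    exact hf (LinearMap.ext h)
  obtain ⟨f0, -, hf0, -⟩ := E 0
  obtain ⟨e, he0⟩ := nz f0 hf0
  have he : e ≠ 0 := fun h => he0 (by simp [h])
  obtain ⟨f, hfS, hf, hfe⟩ := E e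
  obtain ⟨e', hu⟩ := nz f hf
  by_cases hfu : f (f e') = 0
  · obtain ⟨f', hS', hf', hfe'⟩ := E e'
    refine hf' (K e' (f e') ?_ f' hfe' ?_)
    · intro a b h
      have h1 := congrArg f h
      simp only [map_add, map_smul, hfu, smul_zero, add_zero, map_zero] at h1
      have ha := (tf _ _ h1).resolve_right hu
      subst ha
      simp only [zero_smul, zero_add] at h
      exact ⟨rfl, (tf _ _ h).resolve_right hu⟩
    · rw [hc f' hS' f hfS, hfe', map_zero]
  · have hi : ∀ a b : ℤ, a • e + b • f e' = 0 → a = 0 ∧ b = 0 := by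
      intro a b h
      have h1 := congrArg f h
      simp only [map_add, map_smul, hfe, smul_zero, zero_add, map_zero] at h1
      have hb := (tf _ _ h1).resolve_right hfu
      subst hb
      simp only [zero_smul, add_zero] at h
      exact ⟨(tf _ _ h).resolve_right he, rfl⟩
    obtain ⟨f', hS', hf', hs⟩ := E (e + f e')
    have hffu : f' (f (f e')) = 0 := by
      have h1 := congrArg f hs
      rw [map_add, map_add, hc f hfS f' hS', hfe, map_zero, zero_add, map_zero,
        hc f hfS f' hS'] at h1
      exact h1
    obtain ⟨a, b, c, h, hn⟩ := hrk e (f e') e'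
    have h1 : c • f' (f e') = 0 := by
      have := congrArg f' (congrArg f h)
      simpa [hfe, hffu] using this
    rcases tf _ _ h1 with h2 | h2
    · subst h2
      simp only [zero_smul, add_zero] at h
      exact hn ⟨(hi a b h).1, (hi a b h).2, rfl⟩
    · rw [map_add, h2, add_zero] at hs
      exact hf' (K e (f e') hi f' hs h2)

/-- Let `A` be a nontrivial finitely generated abelian group of rank at most 2
(i.e. any 3 elements of `A` are `ℤ`-linearly dependent), and let `R` be a commutative
subring of the endomorphism ring of `A`. Then the additive group of `R` has rank at
most 2, i.e. any 3 elements of `R` are `ℤ`-linearly dependent. -/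
theorem stmt_6 {A : Type*} [AddCommGroup A] [Nontrivial A] (hfg : AddGroup.FG A)
    (hrk : ∀ v : Fin 3 → A, ¬ LinearIndependent ℤ v)
    (R : Subring (Module.End ℤ A)) (hcomm : ∀ x ∈ R, ∀ y ∈ R, x * y = y * x) :
    ∀ v : Fin 3 → R, ¬ LinearIndependent ℤ v := by
  intro v hv
  have hfin : Module.Finite ℤ A := Module.Finite.iff_addGroup_fg.mpr hfg
  have hrk3 : ∀ p q r : A, ∃ a b c : ℤ,
      a • p + b • q + c • r = 0 ∧ ¬ (a = 0 ∧ b = 0 ∧ c = 0) := by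
    intro p q r
    have h := hrk ![p, q, r]
    rw [Fintype.linearIndependent_iff] at h
    push Not at h
    obtain ⟨g, hg, i, hi⟩ := h
    refine ⟨g 0, g 1, g 2, by simpa [Fin.sum_univ_three] using hg, ?_⟩
    rintro ⟨h0, h1, h2⟩
    fin_cases i
    exacts [hi h0, hi h1, hi h2]
  rw [Fintype.linearIndependent_iff] at hv
  let T := Submodule.torsion ℤ A
  have hT : ∀ f : Module.End ℤ A, T ≤ T.comap f := by
    rintro f x ⟨n, hn⟩
    refine ⟨n, ?_⟩
    have := congrArg f hn
    rw [map_zero] at this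
    rw [← this]
    exact (f.map_smul_of_tower n x).symm
  have hTm : ∀ x : A, x ∈ T ↔ ∃ n : ℤ, n ≠ 0 ∧ n • x = 0 := by
    intro x
    constructor
    · rintro ⟨n, hn⟩
      exact ⟨n, nonZeroDivisors.coe_ne_zero n, hn⟩
    · rintro ⟨n, h0, hn⟩
      exact ⟨⟨n, mem_nonZeroDivisors_of_ne_zero h0⟩, hn⟩
  -- nonzero multiples kill torsion-valued endomorphisms
  have hkill : ∀ f : Module.End ℤ A, (∀ x, f x ∈ T) → ∃ n : ℤ, n ≠ 0 ∧ n • f = 0 := by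
    intro f hf
    obtain ⟨s, hs⟩ := hfin.fg_top
    choose N hN0 hN using fun x => (hTm _).1 (hf x)
    refine ⟨∏ x ∈ s, N x, Finset.prod_ne_zero_iff.mpr fun x _ => hN0 x, ?_⟩
    refine LinearMap.ext_on hs ?_
    intro x hx
    obtain ⟨k, hk⟩ := Finset.dvd_prod_of_mem N (Finset.mem_coe.mp hx)
    rw [hk, LinearMap.smul_apply, mul_comm, mul_smul, hN]
    simp
  let Q : Module.End ℤ A → Module.End ℤ (A ⧸ T) := fun f => T.mapQ T f (hT f)
  have hQ : ∀ f x, Q f (Submodule.Quotient.mk x) = Submodule.Quotient.mk (f x) :=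
    fun f x => rfl
  have hR : ∀ f ∈ R, ∀ g ∈ R, ∀ x, f (g x) = g (f x) := fun f hf g hg x =>
    congrArg (fun h : Module.End ℤ A => h x) (hcomm f hf g hg)
  have hrkF : ∀ p q r : A ⧸ T, ∃ a b c : ℤ,
      a • p + b • q + c • r = 0 ∧ ¬ (a = 0 ∧ b = 0 ∧ c = 0) := by
    intro p q r
    obtain ⟨p, rfl⟩ := Submodule.Quotient.mk_surjective _ p
    obtain ⟨q, rfl⟩ := Submodule.Quotient.mk_surjective _ q
    obtain ⟨r, rfl⟩ := Submodule.Quotient.mk_surjective _ r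
    obtain ⟨a, b, c, h, hn⟩ := hrk3 p q r
    refine ⟨a, b, c, ?_, hn⟩
    have := congrArg T.mkQ h
    simpa using this
  refine aux_F (F := A ⧸ T) ?_ hrkF (Q '' R) ?_ ?_
  · intro n a h
    obtain ⟨a, rfl⟩ := Submodule.Quotient.mk_surjective _ a
    rw [← Submodule.Quotient.mk_smul, Submodule.Quotient.mk_eq_zero, hTm] at h
    obtain ⟨m, hm, h⟩ := h
    by_cases hn : n = 0
    · exact Or.inl hn
    · right
      rw [Submodule.Quotient.mk_eq_zero, hTm]
      exact ⟨m * n, mul_ne_zero hm hn, by rw [mul_smul, h]⟩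
  · rintro _ ⟨f, hf, rfl⟩ _ ⟨g, hg, rfl⟩ x
    obtain ⟨x, rfl⟩ := Submodule.Quotient.mk_surjective _ x
    rw [hQ, hQ, hQ, hQ, hR f hf g hg]
  · intro e
    obtain ⟨e, rfl⟩ := Submodule.Quotient.mk_surjective _ e
    obtain ⟨a, b, c, h, hn⟩ := hrk3 ((v 0).1 e) ((v 1).1 e) ((v 2).1 e)
    let f : R := a • v 0 + b • v 1 + c • v 2
    have hfe : f.1 e = a • (v 0).1 e + b • (v 1).1 e + c • (v 2).1 e := rfl
    refine ⟨Q f.1, ⟨f.1, f.2, rfl⟩, ?_, ?_⟩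
    · intro h0
      obtain ⟨n, hn0, hnf⟩ := hkill f.1 (by
        intro x
        rw [← Submodule.Quotient.mk_eq_zero, ← hQ, h0]
        rfl)
      have hnf' : n • f = 0 := Subtype.ext hnf
      have h3 := hv (fun i => n * ![a, b, c] i) (by
        rw [← hnf']
        simp [f, Fin.sum_univ_three, mul_smul, smul_add])
      have e0 := h3 0
      have e1 := h3 1
      have e2 := h3 2
      simp [hn0] at e0 e1 e2
      exact hn ⟨e0, e1, e2⟩
    · rw [hQ, hfe, h]
      rfl
end

section
/- Let X and Y be 2×2 integer matrices that commute, i.e., XY = YX. Then X, Y and the identity matrix I are ℤ-linearly dependent: there exist integers α, β, γ, not all zero, such that αX + βY + γI = 0. Consequently, every commutative subring of the ring of 2×2 integer matrices has additive rank at most 2. -/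
theorem aux_dep (X Y : Matrix (Fin 2) (Fin 2) ℤ) (h : X * Y = Y * X)
    (hX : ¬ ∃ s : ℤ, X = s • (1 : Matrix (Fin 2) (Fin 2) ℤ)) :
    ∃ α β γ : ℤ, β ≠ 0 ∧ α • X + β • Y = γ • (1 : Matrix (Fin 2) (Fin 2) ℤ) := by
  have h00 := congrFun (congrFun h 0) 0
  have h01 := congrFun (congrFun h 0) 1
  have h10 := congrFun (congrFun h 1) 0
  simp only [Matrix.mul_apply, Fin.sum_univ_two] at h00 h01 h10
  by_cases hb : X 0 1 = 0
  · by_cases hc : X 1 0 = 0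
    · by_cases hd : X 0 0 - X 1 1 = 0
      · exfalso
        apply hX
        refine ⟨X 0 0, ?_⟩
        ext i j
        fin_cases i <;> fin_cases j <;> simp [hb, hc]
        linarith
      · refine ⟨Y 0 0 - Y 1 1, -(X 0 0 - X 1 1),
          (Y 0 0 - Y 1 1) * X 0 0 - (X 0 0 - X 1 1) * Y 0 0, by omega, ?_⟩
        ext i j
        fin_cases i <;> fin_cases j <;> simp [-zsmul_eq_mul, -neg_smul] <;> linarith
    · refine ⟨Y 1 0, -X 1 0, Y 1 0 * X 0 0 - X 1 0 * Y 0 0, by simpa using hc, ?_⟩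
      ext i j
      fin_cases i <;> fin_cases j <;> simp [-zsmul_eq_mul, -neg_smul] <;> linarith
  · refine ⟨Y 0 1, -X 0 1, Y 0 1 * X 0 0 - X 0 1 * Y 0 0, by simpa using hb, ?_⟩
    ext i j
    fin_cases i <;> fin_cases j <;> simp [-zsmul_eq_mul, -neg_smul] <;> linarith

theorem aux_three (X Y Z : Matrix (Fin 2) (Fin 2) ℤ) (h : X * Y = Y * X) (h' : X * Z = Z * X)
    (hX : ¬ ∃ s : ℤ, X = s • (1 : Matrix (Fin 2) (Fin 2) ℤ)) :
    ∃ p q r : ℤ, ¬(p = 0 ∧ q = 0 ∧ r = 0) ∧ p • X + q • Y + r • Z = 0 := by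
  obtain ⟨a, b, m, hb, e⟩ := aux_dep X Y h hX
  obtain ⟨a', b', n, hb', e'⟩ := aux_dep X Z h' hX
  by_cases hm : m = 0
  · exact ⟨a, b, 0, by simp [hb], by rw [e, hm]; module⟩
  · refine ⟨n * a - m * a', n * b, -(m * b'), by simp [hm, hb'], ?_⟩
    have : (n * a - m * a') • X + (n * b) • Y + (-(m * b')) • Z
        = n • (a • X + b • Y) - m • (a' • X + b' • Z) := by module
    rw [this, e, e']
    module

theorem aux_all (X Y Z : Matrix (Fin 2) (Fin 2) ℤ) (h : X * Y = Y * X) (h' : X * Z = Z * X)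
    (h'' : Y * Z = Z * Y) :
    ∃ p q r : ℤ, ¬(p = 0 ∧ q = 0 ∧ r = 0) ∧ p • X + q • Y + r • Z = 0 := by
  by_cases hX : ∃ s : ℤ, X = s • (1 : Matrix (Fin 2) (Fin 2) ℤ)
  · by_cases hY : ∃ s : ℤ, Y = s • (1 : Matrix (Fin 2) (Fin 2) ℤ)
    · obtain ⟨s, rfl⟩ := hX
      obtain ⟨t, rfl⟩ := hY
      by_cases hs : s = 0
      · exact ⟨1, 0, 0, by simp, by simp [hs]⟩
      · exact ⟨t, -s, 0, by simp [hs], by module⟩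
    · obtain ⟨p, q, r, hn, e⟩ := aux_three Y X Z h.symm h'' hY
      exact ⟨q, p, r, by tauto, by rw [← e]; module⟩
  · exact aux_three X Y Z h h' hX

/-- Any two commuting 2×2 integer matrices `X`, `Y` are `ℤ`-linearly dependent together
with the identity matrix: there are integers `α, β, γ`, not all zero, with
`αX + βY + γI = 0`. Consequently, every commutative subring of the ring of 2×2 integer
matrices has additive rank at most 2 (any 3 of its elements are `ℤ`-linearly dependent). -/
theorem stmt_7 :
    (∀ X Y : Matrix (Fin 2) (Fin 2) ℤ, X * Y = Y * X →
      ∃ α β γ : ℤ, ¬(α = 0 ∧ β = 0 ∧ γ = 0) ∧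
        α • X + β • Y + γ • (1 : Matrix (Fin 2) (Fin 2) ℤ) = 0) ∧
    (∀ R : Subring (Matrix (Fin 2) (Fin 2) ℤ), (∀ x ∈ R, ∀ y ∈ R, x * y = y * x) →
      ∀ v : Fin 3 → R, ¬ LinearIndependent ℤ v) := by
  constructor
  · intro X Y h
    exact aux_all X Y 1 h (by simp) (by simp)
  · intro R hR v hv
    obtain ⟨p, q, r, hn, e⟩ := aux_all (v 0) (v 1) (v 2) (hR _ (v 0).2 _ (v 1).2)
      (hR _ (v 0).2 _ (v 2).2) (hR _ (v 1).2 _ (v 2).2)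
    have key := Fintype.linearIndependent_iff.1 hv ![p, q, r] (by
      apply Subtype.ext
      simpa [-zsmul_eq_mul, Fin.sum_univ_three] using e)
    exact hn ⟨by simpa using key 0, by simpa using key 1, by simpa using key 2⟩
end

section
/- Let K be a number field with ring of integers O, and let n ≥ 1. Then every solvable subgroup of the general linear group GL(n, O) is polycyclic; in particular, every subgroup of a solvable subgroup of GL(n, O) is finitely generated. -/
universe u v

def MaxG (G : Type*) [Group G] : Prop := ∀ H : Subgroup G, H.FG

theorem fg_ext {G Q : Type*} [Group G] [Group Q] (f : G →* Q) (H : Subgroup G)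
    (h1 : (H.map f).FG) (h2 : (H ⊓ f.ker).FG) : H.FG := by
  classical
  obtain ⟨S, hS⟩ := h1
  have hsub : (S : Set Q) ⊆ f '' (H : Set G) := by
    intro x hx
    have : x ∈ H.map f := hS ▸ Subgroup.subset_closure hx
    exact this
  obtain ⟨T, hT, hTS⟩ := Finset.subset_set_image_iff.1 hsub
  have hTFG : (Subgroup.closure (T : Set G)).FG := ⟨T, rfl⟩
  have : H = Subgroup.closure (T : Set G) ⊔ (H ⊓ f.ker) := by
    apply le_antisymm
    · intro x hx
      have hx' : f x ∈ (Subgroup.closure (T : Set G)).map f := by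
        rw [MonoidHom.map_closure, ← Finset.coe_image, hTS, hS]
        exact ⟨x, hx, rfl⟩
      obtain ⟨y, hy, hyx⟩ := hx'
      have hyH : y ∈ H := (Subgroup.closure_le H).2 hT hy
      have : x = y * (y⁻¹ * x) := by group
      rw [this]
      refine Subgroup.mul_mem_sup hy ⟨H.mul_mem (H.inv_mem hyH) hx, ?_⟩
      change f (y⁻¹ * x) = 1
      rw [map_mul, map_inv, hyx]; simp
    · exact sup_le ((Subgroup.closure_le H).2 hT) inf_le_left
  rw [this]
  exact hTFG.sup h2

theorem fg_map {G Q : Type*} [Group G] [Group Q] (f : G →* Q) (H : Subgroup G)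
    (h : H.FG) : (H.map f).FG := by
  classical
  obtain ⟨S, hS⟩ := h
  exact ⟨S.image f, by rw [← hS, MonoidHom.map_closure, Finset.coe_image]⟩

theorem MaxG.of_surj {G Q : Type*} [Group G] [Group Q] (f : G →* Q)
    (hf : Function.Surjective f) (h : MaxG G) : MaxG Q := by
  intro H
  have := fg_map f _ (h (H.comap f))
  rwa [Subgroup.map_comap_eq_self_of_surjective hf] at this

theorem MaxG.of_inj {G Q : Type*} [Group G] [Group Q] (f : G →* Q)
    (hf : Function.Injective f) (h : MaxG Q) : MaxG G := by
  intro H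
  apply fg_ext f H (h _)
  rw [(MonoidHom.ker_eq_bot_iff f).2 hf, inf_bot_eq]
  exact Subgroup.FG.bot

theorem MaxG.sub {G : Type*} [Group G] (h : MaxG G) (H : Subgroup G) : MaxG H :=
  h.of_inj H.subtype H.subtype_injective

/-- extension, with the kernel and the range -/
theorem MaxG.ext {G Q : Type*} [Group G] [Group Q] (f : G →* Q)
    (h1 : MaxG f.ker) (h2 : MaxG f.range) : MaxG G := by
  intro H
  apply fg_ext f.rangeRestrict H (h2 _)
  rw [MonoidHom.ker_rangeRestrict]
  have := fg_map f.ker.subtype _ (h1 (H.comap f.ker.subtype))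
  rwa [Subgroup.map_comap_eq, Subgroup.range_subtype, inf_comm] at this

theorem MaxG.of_finite {G : Type*} [Group G] [Finite G] : MaxG G := fun H =>
  (Group.fg_iff_subgroup_fg H).1 inferInstance

theorem MaxG.of_finiteIndex {G : Type*} [Group G] (C : Subgroup G) [C.FiniteIndex]
    (h : MaxG C) : MaxG G := by
  apply MaxG.ext (QuotientGroup.mk' C.normalCore)
  · rw [QuotientGroup.ker_mk']
    exact h.of_inj (Subgroup.inclusion C.normalCore_le) (Subgroup.inclusion_injective _)
  · exact MaxG.of_finite

theorem MaxG.of_noeth {A : Type*} [AddCommGroup A] [IsNoetherian ℤ A] :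
    MaxG (Multiplicative A) := by
  intro H
  have : (AddSubgroup.toIntSubmodule (Subgroup.toAddSubgroup' H)).FG := IsNoetherian.noetherian _
  rw [Submodule.fg_iff_addSubgroup_fg] at this
  rw [AddSubgroup.fg_iff_mul_fg] at this
  exact this

theorem MaxG.of_commFG {A : Type*} [CommGroup A] [Group.FG A] : MaxG A := by
  have : Module.Finite ℤ (Additive A) := Module.Finite.iff_addGroup_fg.2 inferInstance
  have := MaxG.of_noeth (A := Additive A)
  exact this.of_inj (MulEquiv.toMultiplicative_toAdditive (G := A)).symm.toMonoidHom  (MulEquiv.injective _)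

/-- A criterion for finite index. -/
theorem finiteIndex_of_fun {G T : Type*} [Group G] (H : Subgroup G) (f : G → T) 
    (hfin : (Set.range f).Finite) (h : ∀ x y, f x = f y → x⁻¹ * y ∈ H) : H.FiniteIndex := by
  have : Finite (Set.range f) := hfin
  have : Finite (G ⧸ H) := by
    apply Finite.of_injective (fun q : G ⧸ H => (⟨f q.out, _, rfl⟩ : Set.range f))
    intro a b hab
    have := h _ _ (Subtype.ext_iff.1 hab)
    rw [← QuotientGroup.eq] at this
    simpa using this
  exact Subgroup.finiteIndex_of_finite_quotient

theorem derived_comm {G : Type*} [Group G] (d : ℕ) :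
    (derivedSeries (commutator G) d).map (commutator G).subtype = derivedSeries G (d + 1) := by
  induction d with
  | zero => simp [← MonoidHom.range_eq_map]
  | succ d ih => rw [derivedSeries_succ, Subgroup.map_commutator, ih, ← derivedSeries_succ]

theorem derived_comm_bot {G : Type*} [Group G] (d : ℕ) (h : derivedSeries G (d + 1) = ⊥) :
    derivedSeries (commutator G) d = ⊥ := by
  rw [← derived_comm] at h
  exact (Subgroup.map_eq_bot_iff_of_injective _ (Subgroup.subtype_injective _)).1 h

/-- A finite index subgroup of a f.g. group contains a finite index subgroup
stable by all automorphisms. -/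
theorem exists_char {D : Type*} [Group D] (hD : MaxG D) (N : Subgroup D) [N.FiniteIndex] :
    ∃ N' : Subgroup D, N' ≤ N ∧ N'.FiniteIndex ∧ ∀ φ : D →* D, ∀ x ∈ N', φ x ∈ N' := by
  classical
  obtain ⟨S, hS⟩ := hD ⊤
  have : Finite (D →* Equiv.Perm (D ⧸ N)) := by
    apply Finite.of_injective (fun f => fun s : S => f s)
    intro f g hfg
    apply MonoidHom.eq_of_eqOn_dense hS
    intro x hx
    exact congrFun hfg ⟨x, hx⟩
  refine ⟨⨅ f : D →* Equiv.Perm (D ⧸ N), f.ker, ?_, ?_, ?_⟩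
  · refine (iInf_le _ (MulAction.toPermHom D (D ⧸ N))).trans ?_
    rw [← Subgroup.normalCore_eq_ker]
    exact Subgroup.normalCore_le N
  · apply Subgroup.finiteIndex_iInf
    intro f
    infer_instance
  · intro φ x hx
    rw [Subgroup.mem_iInf] at hx ⊢
    intro f
    exact hx (f.comp φ)

/-- common eigenvector of a commuting family -/
theorem common_eig {F V ι : Type*} [Field F] [IsAlgClosed F] [AddCommGroup V] [Module F V]
    [FiniteDimensional F V] [Nontrivial V] (f : ι → Module.End F V)
    (hf : ∀ i j, f i * f j = f j * f i) : ∃ v : V, v ≠ 0 ∧ ∀ i, ∃ c : F, f i v = c • v := by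
  let P : Set (Submodule F V) := {U | U ≠ ⊥ ∧ ∀ i, ∀ u ∈ U, f i u ∈ U}
  have hP : P.Nonempty := ⟨⊤, top_ne_bot, fun _ _ _ => trivial⟩
  obtain ⟨U, ⟨hU0, hU⟩, hmin⟩ := wellFounded_lt.has_min P hP
  obtain ⟨v, hv, hv0⟩ := U.ne_bot_iff.1 hU0
  have hnt : Nontrivial U := Submodule.nontrivial_iff_ne_bot.2 hU0
  refine ⟨v, hv0, fun i => ?_⟩
  obtain ⟨μ, hμ⟩ := Module.End.exists_eigenvalue ((f i).restrict (hU i))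
  refine ⟨μ, ?_⟩
  obtain ⟨w, hw, hw0⟩ := hμ.exists_hasEigenvector
  rw [Module.End.mem_eigenspace_iff] at hw
  have hw' : f i (w : V) = μ • (w : V) := by
    have := congrArg Subtype.val hw
    simpa using this
  have hQ : U ⊓ (f i).eigenspace μ ∈ P := by
    constructor
    · rw [Submodule.ne_bot_iff]
      refine ⟨w, ⟨w.2, ?_⟩, by simpa using hw0⟩
      exact Module.End.mem_eigenspace_iff.2 hw'
    · rintro j u ⟨hu, hu'⟩
      refine ⟨hU j u hu, ?_⟩
      have hu'' := Module.End.mem_eigenspace_iff.1 hu'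
      refine Module.End.mem_eigenspace_iff.2 ?_
      have := LinearMap.congr_fun (hf i j) u
      simp only [Module.End.mul_apply] at this
      rw [this, hu'', map_smul]
  have := hmin _ hQ
  have h2 : U ⊓ (f i).eigenspace μ = U := by
    by_contra hne
    exact this (lt_of_le_of_ne inf_le_left hne)
  have h3 : v ∈ U ⊓ (f i).eigenspace μ := h2.symm ▸ hv
  exact Module.End.mem_eigenspace_iff.1 h3.2

theorem T2 {G F V : Type*} [Group G] [Field F] [IsAlgClosed F] [AddCommGroup V] [Module F V]
    [FiniteDimensional F V] [Nontrivial V] (ρ : G →* Module.End F V)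
    (N : Subgroup G) (hN : (N.subgroupOf (commutator G)).FiniteIndex)
    (hs : ∀ g ∈ N, ∃ c : F, ρ g = c • 1) :
    ∃ C : Subgroup G, C.FiniteIndex ∧ ∃ v : V, v ≠ 0 ∧ ∀ g ∈ C, ∃ c : F, ρ g v = c • v := by
  classical
  -- determinant one on commutators
  have hdet : ∀ g ∈ commutator G, LinearMap.det (ρ g) = 1 := by
    intro g hg
    have h := Abelianization.commutator_subset_ker
      ((LinearMap.det.comp ρ : G →* F).toHomUnits) hg
    have h2 := congrArg Units.val (MonoidHom.mem_ker.1 h)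
    simpa using h2
  have hn : Module.finrank F V ≠ 0 := Module.finrank_pos.ne'
  -- scalars: finite
  have hfinN : (ρ '' ((N ⊓ commutator G : Subgroup G) : Set G)).Finite := by
    have hroots : ({c : F | c ^ Module.finrank F V = 1}).Finite := by
      have hp : (Polynomial.X ^ Module.finrank F V - 1 : Polynomial F) ≠ 0 := 
        Polynomial.X_pow_sub_C_ne_zero (Nat.pos_of_ne_zero hn) 1
      refine (Polynomial.finite_setOfPred_isRoot hp).subset ?_
      intro c hc
      simp only [Set.mem_ofPred_eq] at hc
      simp [Polynomial.IsRoot, hc]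
    refine (hroots.image (fun c : F => (c • 1 : Module.End F V))).subset ?_
    rintro _ ⟨g, ⟨hg, hg'⟩, rfl⟩
    obtain ⟨c, hc⟩ := hs g hg
    refine ⟨c, ?_, hc.symm⟩
    have := hdet g hg'
    rw [hc, LinearMap.det_smul] at this
    simpa using this
  have hfinD : (ρ '' (commutator G : Set G)).Finite := by
    have : Finite (commutator G ⧸ (N.subgroupOf (commutator G))) := 
      Subgroup.finite_quotient_of_finiteIndex
    have hf : (⋃ q : commutator G ⧸ (N.subgroupOf (commutator G)),
      (fun x => ρ (q.out : commutator G) * x) '' (ρ '' ((N ⊓ commutator G : Subgroup G) : Set G))).Finite :=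
      Set.finite_iUnion fun q => hfinN.image _
    refine hf.subset ?_
    rintro _ ⟨g, hg, rfl⟩
    rw [Set.mem_iUnion]
    let q : commutator G ⧸ (N.subgroupOf (commutator G)) := ((⟨g, hg⟩ : commutator G) : _ ⧸ _)
    refine ⟨q, ρ ((q.out : G)⁻¹ * g), ⟨_, ⟨?_, ?_⟩, rfl⟩, ?_⟩
    · have : (q.out : commutator G)⁻¹ * ⟨g, hg⟩ ∈ N.subgroupOf (commutator G) := by
        rw [← QuotientGroup.eq]; simp [q]
      exact Subgroup.mem_subgroupOf.1 this
    · exact (commutator G).mul_mem ((commutator G).inv_mem q.out.2) hg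
    · simp only [← map_mul]; simp
  have hinv : ∀ x : G, ρ x * ρ x⁻¹ = 1 := fun x => by rw [← map_mul]; simp
  have hinv' : ∀ x : G, ρ x⁻¹ * ρ x = 1 := fun x => by rw [← map_mul]; simp
  -- centralizers
  let C : G → Subgroup G := fun g =>
    { carrier := {x | ρ x * ρ g = ρ g * ρ x}
      one_mem' := by simp
      mul_mem' := by
        intro a b ha hb
        simp only [Set.mem_ofPred_eq, map_mul] at *
        rw [mul_assoc, hb, ← mul_assoc, ha, mul_assoc]
      inv_mem' := by
        intro a ha
        simp only [Set.mem_ofPred_eq] at *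
        calc ρ a⁻¹ * ρ g = ρ a⁻¹ * (ρ g * ρ a) * ρ a⁻¹ := by
              rw [mul_assoc, mul_assoc, hinv, mul_one]
          _ = ρ g * ρ a⁻¹ := by rw [← ha, ← mul_assoc, hinv', one_mul] }
  have hC : ∀ g, (C g).FiniteIndex := by
    intro g
    apply finiteIndex_of_fun (C g) (fun x => ρ (x * g * x⁻¹ * g⁻¹))
    · refine hfinD.subset ?_
      rintro _ ⟨x, rfl⟩
      refine ⟨_, ?_, rfl⟩
      exact Subgroup.commutator_mem_commutator (Subgroup.mem_top x) (Subgroup.mem_top g)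
    · intro x y hxy
      change ρ (x⁻¹ * y) * ρ g = ρ g * ρ (x⁻¹ * y)
      have e1 : x⁻¹ * y * g = x⁻¹ * (y * g * y⁻¹ * g⁻¹) * (g * y) := by group
      have e2 : g * (x⁻¹ * y) = x⁻¹ * (x * g * x⁻¹ * g⁻¹) * (g * y) := by group
      have hxy' : ρ (x * g * x⁻¹ * g⁻¹) = ρ (y * g * y⁻¹ * g⁻¹) := hxy
      rw [← map_mul, ← map_mul, e1, e2, map_mul, map_mul, ← hxy', ← map_mul, ← map_mul]
  -- finite spanning set
  obtain ⟨b, hb, hspan, hli⟩ := exists_linearIndependent F (Set.range ρ)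
  have hbfin : b.Finite := hli.setFinite
  obtain ⟨S, hS⟩ : ∃ S : Finset G, b ⊆ ρ '' S := by
    obtain ⟨t, ht⟩ := hbfin.exists_finset_coe
    rw [← ht, ← Set.image_univ] at hb
    obtain ⟨S, -, hS⟩ := Finset.subset_set_image_iff.1 hb
    exact ⟨S, by rw [← ht, ← hS, Finset.coe_image]⟩
  let Z : Subgroup G := ⨅ g ∈ S, C g
  have hZ : Z.FiniteIndex := Subgroup.finiteIndex_iInf' _ fun i _ => hC i
  refine ⟨Z, hZ, ?_⟩
  have hcomm : ∀ x ∈ Z, ∀ y, ρ x * ρ y = ρ y * ρ x := by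
    intro x hx y
    have hx' : ∀ g ∈ S, ρ x * ρ g = ρ g * ρ x := by
      intro g hg
      have h1 := (Subgroup.mem_iInf.1 ((Subgroup.mem_iInf.1 hx) g)) hg
      exact h1
    have hy : ρ y ∈ Submodule.span F b := hspan ▸ Submodule.subset_span ⟨y, rfl⟩
    generalize ρ y = z at hy
    induction hy using Submodule.span_induction with
    | mem z hz =>
      obtain ⟨g, hg, rfl⟩ := hS hz
      exact hx' g hg
    | zero => simp
    | add a b _ _ ha hb => rw [mul_add, add_mul, ha, hb]
    | smul c a _ ha => rw [mul_smul_comm, smul_mul_assoc, ha]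
  obtain ⟨v, hv, h⟩ := common_eig (fun x : Z => ρ x) (fun x y => hcomm x x.2 y)
  exact ⟨v, hv, fun g hg => h ⟨g, hg⟩⟩

theorem T1 {F V : Type*} [Field F] [IsAlgClosed F] [AddCommGroup V] [Module F V]
    [FiniteDimensional F V] [Nontrivial V] (d : ℕ) :
    ∀ (G : Type u) [Group G], derivedSeries G d = ⊥ → MaxG (commutator G) →
    ∀ ρ : G →* Module.End F V,
    ∃ C : Subgroup G, C.FiniteIndex ∧ ∃ v : V, v ≠ 0 ∧ ∀ g ∈ C, ∃ c : F, ρ g v = c • v := by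
  classical
  induction d with
  | zero =>
    intro G _ hd _ ρ
    obtain ⟨v, hv⟩ := exists_ne (0 : V)
    refine ⟨⊤, inferInstance, v, hv, fun g hg => ⟨1, ?_⟩⟩
    rw [derivedSeries_zero] at hd
    rw [hd, Subgroup.mem_bot] at hg
    simp [hg]
  | succ d ih =>
    intro G _ hd hmax ρ
    obtain ⟨C, hC, v, hv, hCv⟩ := ih (commutator G) (derived_comm_bot d hd) (hmax.sub _)
      (ρ.comp (commutator G).subtype)
    obtain ⟨N', hN'C, hN'fin, hN'char⟩ := exists_char hmax C
    let N : Subgroup G := N'.map (commutator G).subtype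
    have hNconj : ∀ x : G, ∀ g ∈ N, x * g * x⁻¹ ∈ N := by
      rintro x _ ⟨g, hg, rfl⟩
      exact ⟨_, hN'char (MulAut.conjNormal x).toMonoidHom g hg, by simp⟩
    have hNconj' : ∀ x : G, ∀ g ∈ N, x⁻¹ * g * x ∈ N := by
      intro x g hg
      simpa using hNconj x⁻¹ g hg
    obtain ⟨S, hS⟩ : N.FG := fg_map _ _ (hmax N')
    have hNv : ∀ g ∈ N, ∃ c : F, ρ g v = c • v := by
      rintro _ ⟨g, hg, rfl⟩
      exact hCv g (hN'C hg)
    choose! χ hχ using hNv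
    have hχmul : ∀ g ∈ N, ∀ h ∈ N, χ (g * h) = χ g * χ h := by
      intro g hg h hh
      have h1 := hχ _ (N.mul_mem hg hh)
      rw [map_mul, Module.End.mul_apply, hχ h hh, map_smul, hχ g hg, smul_smul] at h1
      rw [mul_comm]
      exact (smul_left_injective F hv h1).symm
    have hχone : χ 1 = 1 := by
      have h1 := hχ 1 N.one_mem
      rw [map_one, Module.End.one_apply] at h1
      exact (smul_left_injective F hv (by simpa using h1)).symm
    have hχinv : ∀ g ∈ N, χ g⁻¹ = (χ g)⁻¹ := by
      intro g hg
      apply eq_inv_of_mul_eq_one_left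
      rw [← hχmul _ (N.inv_mem hg) _ hg, inv_mul_cancel, hχone]
    let G1 : Subgroup G :=
      { carrier := {x | ∀ g ∈ N, χ (x⁻¹ * g * x) = χ g}
        one_mem' := by intro g _; simp
        mul_mem' := by
          intro a b ha hb g hg
          have e : (a * b)⁻¹ * g * (a * b) = b⁻¹ * (a⁻¹ * g * a) * b := by group
          rw [e, hb _ (hNconj' a g hg), ha g hg]
        inv_mem' := by
          intro a ha g hg
          have h1 := ha _ (hNconj a g hg)
          have e : a⁻¹ * (a * g * a⁻¹) * a = g := by group
          rw [e] at h1
          rw [inv_inv, ← h1] }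
    have hagree : ∀ x y : G, (∀ s ∈ S, χ (x⁻¹ * s * x) = χ (y⁻¹ * s * y)) →
        ∀ g ∈ N, χ (x⁻¹ * g * x) = χ (y⁻¹ * g * y) := by
      intro x y hxy g hg
      rw [← hS] at hg
      induction hg using Subgroup.closure_induction with
      | mem s hs => exact hxy s hs
      | one => simp
      | mul a b ha hb iha ihb =>
        rw [hS] at ha hb
        have e : ∀ x : G, x⁻¹ * (a * b) * x = (x⁻¹ * a * x) * (x⁻¹ * b * x) := by intro x; group
        rw [e, e, hχmul _ (hNconj' _ _ ha) _ (hNconj' _ _ hb),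
          hχmul _ (hNconj' _ _ ha) _ (hNconj' _ _ hb), iha, ihb]
      | inv a ha iha =>
        rw [hS] at ha
        have e : ∀ x : G, x⁻¹ * a⁻¹ * x = (x⁻¹ * a * x)⁻¹ := by intro x; group
        rw [e, e, hχinv _ (hNconj' _ _ ha), hχinv _ (hNconj' _ _ ha), iha]
    have hG1 : G1.FiniteIndex := by
      apply finiteIndex_of_fun G1 (fun x => fun s : S => χ (x⁻¹ * s * x))
      · have hfin : (Set.pi Set.univ
            (fun s : S => {μ : F | (ρ (s : G)).HasEigenvalue μ})).Finite :=
          Set.Finite.pi fun s => Module.End.finite_hasEigenvalue _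
        refine hfin.subset ?_
        rintro _ ⟨x, rfl⟩ s -
        have hsN : (s : G) ∈ N := hS ▸ Subgroup.subset_closure s.2
        change (ρ (s : G)).HasEigenvalue (χ (x⁻¹ * s * x))
        apply Module.End.hasEigenvalue_of_hasEigenvector (x := ρ x v)
        refine ⟨Module.End.mem_eigenspace_iff.2 ?_, ?_⟩
        · rw [← map_smul, ← hχ _ (hNconj' x _ hsN), ← Module.End.mul_apply, ← Module.End.mul_apply,
            ← map_mul, ← map_mul]
          congr 2; group
        · intro h0
          apply hv
          have : ρ x⁻¹ (ρ x v) = v := by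
            rw [← Module.End.mul_apply, ← map_mul]; simp
          rw [← this, h0, map_zero]
      · intro x y hxy g hg
        have := hagree x y (fun s hs => congrFun hxy ⟨s, hs⟩) _ (hNconj x g hg)
        have e1 : x⁻¹ * (x * g * x⁻¹) * x = g := by group
        have e2 : (x⁻¹ * y)⁻¹ * g * (x⁻¹ * y) = y⁻¹ * (x * g * x⁻¹) * y := by group
        rw [e1] at this
        rw [e2, ← this]
    let W : Submodule F V :=
      { carrier := {w | ∀ g ∈ N, ρ g w = χ g • w}
        zero_mem' := by intro g _; simp
        add_mem' := by
          intro a b ha hb g hg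
          rw [map_add, ha g hg, hb g hg, smul_add]
        smul_mem' := by
          intro c a ha g hg
          rw [map_smul, ha g hg, smul_comm] }
    have hWG1 : ∀ x ∈ G1, ∀ w ∈ W, ρ x w ∈ W := by
      intro x hx w hw g hg
      rw [← hx g hg, ← map_smul, ← hw _ (hNconj' x g hg), ← Module.End.mul_apply,
        ← Module.End.mul_apply, ← map_mul, ← map_mul]
      congr 2; group
    have hWnt : Nontrivial W := ⟨⟨⟨v, hχ⟩, 0, by simpa [Subtype.ext_iff] using hv⟩⟩
    let ρ1 : G1 →* Module.End F W :=
      { toFun := fun x => (ρ x).restrict (hWG1 x x.2)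
        map_one' := by ext; simp
        map_mul' := by intro x y; ext; simp }
    have hcle : ∀ x : commutator G1, ((x : G1) : G) ∈ commutator G := by
      rintro ⟨x, hx⟩
      have h1 : (commutator G1).map G1.subtype ≤ commutator G := by
        rw [commutator_def, Subgroup.map_commutator, commutator_def]
        exact Subgroup.commutator_mono le_top le_top
      exact h1 ⟨x, hx, rfl⟩
    let j : commutator G1 →* commutator G :=
      (G1.subtype.comp (commutator G1).subtype).codRestrict (commutator G) hcle
    have hj : (N.subgroupOf G1).subgroupOf (commutator G1) = N'.comap j := by
      ext x
      rw [Subgroup.mem_subgroupOf, Subgroup.mem_subgroupOf, Subgroup.mem_comap]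
      constructor
      · rintro ⟨y, hy, hyx⟩
        have : y = j x := Subtype.ext hyx
        exact this ▸ hy
      · intro h
        exact ⟨_, h, rfl⟩
    obtain ⟨C1, hC1, w, hw, hC1w⟩ := T2 ρ1 (N.subgroupOf G1) (by
      rw [hj]
      constructor
      rw [Subgroup.index_comap]
      have hfi : (N'.subgroupOf j.range).FiniteIndex := inferInstance
      exact hfi.1) (by
      intro g hg
      refine ⟨χ g, ?_⟩
      ext w
      exact w.2 g hg)
    refine ⟨C1.map G1.subtype, ?_, w, by simpa using hw, ?_⟩
    · constructor
      rw [Subgroup.index_map_subtype]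
      exact mul_ne_zero hC1.1 hG1.1
    · rintro _ ⟨g, hg, rfl⟩
      obtain ⟨c, hc⟩ := hC1w g hg
      exact ⟨c, congrArg Subtype.val hc⟩

open NumberField in
/-- Elements of a finitely generated subgroup of units. -/
theorem units_max (F : Type*) [Field F] [CharZero F] [Algebra.IsAlgebraic ℚ F] (S : Set F)
    (hS : S.Finite) (A : Subgroup Fˣ)
    (hA : ∀ a ∈ A, (a : F) ∈ IntermediateField.adjoin ℚ S ∧ IsIntegral ℤ (a : F)) : MaxG A := by
  let E := IntermediateField.adjoin ℚ S
  have : Finite S := hS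
  have hfd : FiniteDimensional ℚ E :=
    IntermediateField.finiteDimensional_adjoin fun x _ => Algebra.IsIntegral.isIntegral x
  have : NumberField E := { to_charZero := inferInstance, to_finiteDimensional := hfd }
  let ι : (𝓞 E)ˣ →* Fˣ := Units.map (algebraMap (𝓞 E) F).toMonoidHom
  have hle : A ≤ ι.range := by
    intro a ha
    have h1 : ∀ a ∈ A, ∃ b : 𝓞 E, algebraMap (𝓞 E) F b = a := by
      intro a ha
      obtain ⟨hE, hI⟩ := hA a ha
      have hI' : IsIntegral ℤ (⟨a, hE⟩ : E) := by
        rw [← isIntegral_algebraMap_iff (algebraMap E F).injective]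
        exact hI
      exact ⟨⟨⟨a, hE⟩, hI'⟩, rfl⟩
    obtain ⟨b, hb⟩ := h1 a ha
    obtain ⟨c, hc⟩ := h1 a⁻¹ (A.inv_mem ha)
    have hinj : Function.Injective (algebraMap (𝓞 E) F) := by
      rw [IsScalarTower.algebraMap_eq (𝓞 E) E F]
      exact (algebraMap E F).injective.comp (RingOfIntegers.coe_injective)
    have hbc : b * c = 1 := by
      apply hinj
      rw [map_mul, hb, hc, map_one]; simp
    refine ⟨⟨b, c, hbc, by rw [mul_comm]; exact hbc⟩, ?_⟩
    ext
    exact hb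
  have hfg : Group.FG (𝓞 E)ˣ := Group.fg_iff_monoid_fg.2 inferInstance
  have h2 : MaxG ι.range := (MaxG.of_commFG (A := (𝓞 E)ˣ)).of_surj ι.rangeRestrict
    ι.rangeRestrict_surjective
  exact h2.of_inj (Subgroup.inclusion hle) (Subgroup.inclusion_injective hle)

theorem S1 (n : ℕ) : ∀ (d : ℕ) (G : Type u) [Group G] (M : Type v) [AddCommGroup M]
    [Module.Free ℤ M] [Module.Finite ℤ M], Module.finrank ℤ M = n → derivedSeries G d = ⊥ →
    ∀ ρ : G →* Module.End ℤ M, Function.Injective ρ → MaxG G := by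
  classical
  induction n using Nat.strong_induction_on with
  | _ n ihn =>
  intro d
  induction d with
  | zero =>
    intro G _ M _ _ _ _ hd ρ _
    rw [derivedSeries_zero] at hd
    have : Subsingleton G := Subgroup.subsingleton_iff.1 (subsingleton_of_top_le_bot hd.le)
    exact MaxG.of_finite
  | succ d ihd =>
    intro G _ M _ _ _ hM hd ρ hρ
    have hmax : MaxG (commutator G) := ihd (commutator G) M hM (derived_comm_bot d hd)
      (ρ.comp (commutator G).subtype) (hρ.comp (Subgroup.subtype_injective _))
    rcases subsingleton_or_nontrivial M with hsub | hnt
    · have : Subsingleton G := ⟨fun a b => hρ (Subsingleton.elim _ _)⟩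
      exact MaxG.of_finite
    let F := AlgebraicClosure ℚ
    let b := Module.Free.chooseBasis ℤ M
    have hι : Nonempty (Module.Free.ChooseBasisIndex ℤ M) := b.index_nonempty
    have hVnt : Nontrivial (M →ₗ[ℤ] F) := (b.constr F).symm.toEquiv.nontrivial
    let ρ' : G →* Module.End F (M →ₗ[ℤ] F) :=
      { toFun := fun g =>
          { toFun := fun φ => φ ∘ₗ ρ g⁻¹
            map_add' := by intro x y; rfl
            map_smul' := by intro c x; rfl }
        map_one' := by ext; simp
        map_mul' := by intro x y; ext; simp }
    obtain ⟨C, hC, φ, hφ, hCφ⟩ := T1 (d + 1) G hd hmax ρ'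
    choose! χ hχ using hCφ
    have hχ' : ∀ g ∈ C, ∀ m, φ (ρ g⁻¹ m) = χ g * φ m := by
      intro g hg m
      exact LinearMap.congr_fun (hχ g hg) m
    obtain ⟨m0, hm0⟩ : ∃ m0, φ m0 ≠ 0 := by
      by_contra! h
      exact hφ (LinearMap.ext h)
    have hχmul : ∀ g ∈ C, ∀ h ∈ C, χ (g * h) = χ g * χ h := by
      intro g hg h hh
      have h1 := hχ' _ (C.mul_mem hg hh) m0
      rw [mul_inv_rev, map_mul, Module.End.mul_apply, hχ' h hh, hχ' g hg, ← mul_assoc] at h1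
      rw [mul_comm (χ g)]
      exact (mul_right_cancel₀ hm0 h1).symm
    have hχone : χ 1 = 1 := by
      have h1 := hχ' 1 C.one_mem m0
      rw [inv_one, map_one, Module.End.one_apply] at h1
      exact (mul_right_cancel₀ hm0 (by simpa using h1)).symm
    let χh : C →* Fˣ := MonoidHom.toHomUnits
      { toFun := fun g => χ g
        map_one' := hχone
        map_mul' := fun g h => hχmul g g.2 h h.2 }
    have hχh : ∀ g : C, (χh g : F) = χ g := fun g => rfl
    -- the range of χ is noetherian
    have hχmax : MaxG χh.range := by
      have halg : @Algebra.IsAlgebraic ℚ F _ _ DivisionRing.toRatAlgebra := by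
        have h0 := AlgebraicClosure.isAlgebraic ℚ
        convert h0
        · rfl
        · exact Subsingleton.elim (α := Algebra ℚ (AlgebraicClosure ℚ)) _ _
      apply units_max F (Set.range (φ ∘ b)) (Set.finite_range _)
      rintro _ ⟨g, rfl⟩
      rw [hχh]
      have hmem : ∀ m, φ m ∈ IntermediateField.adjoin ℚ (Set.range (φ ∘ b)) := by
        intro m
        rw [← b.sum_repr m, map_sum]
        refine sum_mem fun i _ => ?_
        rw [map_zsmul]
        exact zsmul_mem (IntermediateField.subset_adjoin ℚ _ (Set.mem_range_self (f := φ ∘ b) i)) _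
      constructor
      · have : χ g = φ (ρ (g : G)⁻¹ m0) / φ m0 := by
          rw [hχ' g g.2, mul_div_cancel_right₀ _ hm0]
        rw [this]
        exact div_mem (hmem _) (hmem _)
      · refine isIntegral_of_smul_mem_submodule (LinearMap.range φ) ?_ ?_ _ ?_
        · intro h
          apply hm0
          have h1 : φ m0 ∈ LinearMap.range φ := ⟨m0, rfl⟩
          rw [h] at h1
          simpa using h1
        · exact Module.Finite.iff_fg.1 inferInstance
        · rintro _ ⟨m, rfl⟩
          exact ⟨ρ (g : G)⁻¹ m, hχ' g g.2 m⟩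
    -- the invariant sublattice
    let M0 : Submodule ℤ M := LinearMap.ker φ
    have hM0 : ∀ g : C, ∀ m ∈ M0, ρ g m ∈ M0 := by
      intro g m hm
      have h1 := hχ' (g : G)⁻¹ (C.inv_mem g.2) m
      rw [inv_inv, LinearMap.mem_ker.1 hm, mul_zero] at h1
      exact LinearMap.mem_ker.2 h1
    have hrank : Module.finrank ℤ M0 < n := by
      have h1 := Submodule.finrank_quotient_add_finrank M0
      have h2 : 0 < Module.finrank ℤ (M ⧸ M0) := by
        rw [LinearEquiv.finrank_eq (φ.quotKerEquivRange)]
        have : Nontrivial (LinearMap.range φ) :=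
          ⟨⟨φ m0, m0, rfl⟩, 0, by simpa [Subtype.ext_iff] using hm0⟩
        exact Module.finrank_pos
      omega
    let ρ0 : C →* Module.End ℤ M0 :=
      { toFun := fun g => (ρ g).restrict (hM0 g)
        map_one' := by ext; simp
        map_mul' := by intro x y; ext; simp }
    apply MaxG.of_finiteIndex C
    let r := ρ0.toHomUnits
    apply MaxG.ext r
    · -- kernel
      apply MaxG.ext (χh.comp r.ker.subtype)
      · let K := (χh.comp r.ker.subtype).ker
        have hK0 : ∀ g : K, ∀ m ∈ M0, ρ (((g : r.ker) : C) : G) m = m := by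
          intro g m hm
          have h1 : r g = 1 := g.1.2
          have h2 : ρ0 g = 1 := congrArg Units.val h1
          exact congrArg Subtype.val (LinearMap.congr_fun h2 ⟨m, hm⟩)
        have hK1 : ∀ g : K, ∀ m, ρ (((g : r.ker) : C) : G) m - m ∈ M0 := by
          intro g m
          have h1 : χh (((g⁻¹ : K) : r.ker) : C) = 1 := (g⁻¹).2
          have h2 : χ ((((g : r.ker) : C) : G)⁻¹) = 1 := congrArg Units.val h1
          have h3 := hχ' _ (C.inv_mem ((g : r.ker) : C).2) m
          rw [inv_inv, h2, one_mul] at h3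
          rw [LinearMap.mem_ker, map_sub, h3, sub_self]
        let δ : K →* Multiplicative (Module.End ℤ M) :=
          { toFun := fun g => Multiplicative.ofAdd (ρ (((g : r.ker) : C) : G) - 1)
            map_one' := by simp
            map_mul' := by
              intro x y
              rw [← ofAdd_add]
              congr 1
              ext m
              have h1 := hK0 x _ (hK1 y m)
              rw [map_sub] at h1
              simp only [Subgroup.coe_mul, map_mul, LinearMap.sub_apply, LinearMap.add_apply,
                Module.End.mul_apply, Module.End.one_apply]
              rw [sub_eq_sub_iff_add_eq_add] at h1
              rw [← add_sub_assoc, sub_left_inj, sub_add_eq_add_sub, eq_sub_iff_add_eq]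
              rw [h1, add_comm] }
        refine (MaxG.of_noeth (A := Module.End ℤ M)).of_inj δ ?_
        intro x y hxy
        have h1 := Multiplicative.ofAdd.injective hxy
        have h2 := hρ (sub_left_injective h1)
        exact Subtype.ext (Subtype.ext (Subtype.ext h2))
      · have hle : (χh.comp r.ker.subtype).range ≤ χh.range := by
          rintro _ ⟨x, rfl⟩
          exact ⟨_, rfl⟩
        exact hχmax.of_inj (Subgroup.inclusion hle) (Subgroup.inclusion_injective hle)
    · -- image in the automorphisms of M0
      have hsol : Group.IsSolvable G := ⟨⟨_, hd⟩⟩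
      have hsolQ : Group.IsSolvable (C ⧸ r.ker) := inferInstance
      obtain ⟨d', hd'⟩ := hsolQ.solvable
      have hQ : MaxG (C ⧸ r.ker) := ihn _ hrank d' (C ⧸ r.ker) M0 rfl hd'
        ((Units.coeHom _).comp (QuotientGroup.kerLift r))
        (Units.val_injective.comp (QuotientGroup.kerLift_injective r))
      exact hQ.of_surj (QuotientGroup.quotientKerEquivRange r).toMonoidHom
        (MulEquiv.surjective _)

/-- Let `K` be a number field with ring of integers `O` and `n ≥ 1`. Every solvable
subgroup `H` of `GL(n, O)` is polycyclic; since polycyclic means solvable with all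
subgroups finitely generated, and `H` is solvable by assumption, this says that every
subgroup of `H` is finitely generated. -/
theorem stmt_15 (K : Type*) [Field K] [NumberField K] (n : ℕ) (hn : 1 ≤ n)
    (H : Subgroup (Matrix.GeneralLinearGroup (Fin n) (NumberField.RingOfIntegers K)))
    (hH : IsSolvable H) :
    ∀ L : Subgroup H, L.FG := by
  obtain ⟨d, hd⟩ := hH.solvable
  let O := NumberField.RingOfIntegers K
  let ρ : H →* Module.End ℤ (Fin n → O) :=
    { toFun := fun g => (Matrix.toLin' ((g : Matrix.GeneralLinearGroup (Fin n) O) : Matrix (Fin n) (Fin n) O)).restrictScalars ℤ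
      map_one' := by
        refine LinearMap.ext fun v => ?_
        simp
      map_mul' := by
        intro x y
        refine LinearMap.ext fun v => ?_
        simp [Matrix.mulVec_mulVec] }
  refine S1 _ d H (Fin n → O) rfl hd ρ ?_
  intro x y hxy
  have h1 := LinearMap.restrictScalars_injective ℤ hxy
  have h2 := Matrix.toLin'.injective h1
  exact Subtype.ext (Units.ext h2)
end
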